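/- arXiv:1212.3684 — 6 statements merged into one kernel-verified Lean document; each statement's English description precedes it below -/
import Mathlib

section
/- Let Q ⊂ ℝⁿ be a cube with center c_Q and sidelength ℓ(Q), let b ∈ L^∞(μ), and let x ∈ Q and 0 < t ≤ ℓ(Q). Then |θ_t(b·χ_{(3Q)^c})(x)| ≲ ‖b‖_∞ · t^α · ℓ(Q)^{−α}; in particular ∫_{Q^c} |y − c_Q|^{−α} / λ(c_Q, |y − c_Q|) dμ(y) ≲ ℓ(Q)^{−α}. -/
open MeasureTheory Set

noncomputable section

/-- The axis-parallel cube in `ℝⁿ` (with the `ℓ^∞` metric) with center `c` and sidelength `L`,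
realized as the closed `ℓ^∞` ball of radius `L/2`. -/
def Cube {n : ℕ} (c : Fin n → ℝ) (L : ℝ) : Set (Fin n → ℝ) :=
  Metric.closedBall c (L / 2)

/-- If balls centered at `x` satisfy `μ (B(x, r)) ≤ ℓ r` with `ℓ` non-decreasing and doubling, then
`∫ |y - x|^{-α} / ℓ (|y - x|) dμ(y)` over the complement of `B(x, R)` is `≲ R^{-α}`. -/
theorem lintegral_dist_rpow_div_le {X : Type*} [PseudoMetricSpace X] [MeasurableSpace X]
    [OpensMeasurableSpace X] (μ : Measure X) (x : X) (l : ℝ → ℝ) {α D R : ℝ}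
    (hα : 0 < α) (hR : 0 < R) (hpos : ∀ r, 0 < r → 0 < l r)
    (hmono : ∀ r r', 0 < r → r ≤ r' → l r ≤ l r')
    (hdouble : ∀ r, 0 < r → l (2 * r) ≤ D * l r)
    (hball : ∀ r, 0 < r → μ (Metric.ball x r) ≤ ENNReal.ofReal (l r)) :
    ∫⁻ y in {y | R ≤ dist y x}, ENNReal.ofReal (dist y x ^ (-α) / l (dist y x)) ∂μ
      ≤ ENNReal.ofReal (D * (1 - (2 : ℝ) ^ (-α))⁻¹ * R ^ (-α)) := by
  have hq0 : 0 ≤ (2 : ℝ) ^ (-α) := by positivity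
  have hq1 : (2 : ℝ) ^ (-α) < 1 := Real.rpow_lt_one_of_one_lt_of_neg one_lt_two (neg_lt_zero.2 hα)
  have hD : 0 ≤ D := by
    have h1 := hpos R hR
    have h2 := hpos (2 * R) (by positivity)
    by_contra! h
    nlinarith [hdouble R hR]
  let A : ℕ → Set X := fun k => {y | 2 ^ k * R ≤ dist y x ∧ dist y x < 2 * (2 ^ k * R)}
  have hA : ∀ k, MeasurableSet (A k) := fun k =>
    ((isClosed_le continuous_const (continuous_id.dist continuous_const)).measurableSet).inter
      ((isOpen_lt (continuous_id.dist continuous_const) continuous_const).measurableSet)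
  have hcover : {y | R ≤ dist y x} ⊆ ⋃ k, A k := by
    intro y hy
    obtain ⟨k, hk1, hk2⟩ := exists_nat_pow_near ((one_le_div hR).2 hy) (one_lt_two (α := ℝ))
    refine mem_iUnion.2 ⟨k, (le_div_iff₀ hR).1 hk1, ?_⟩
    have := (div_lt_iff₀ hR).1 hk2
    rw [pow_succ] at this
    linarith
  have hannulus : ∀ k, ∫⁻ y in A k, ENNReal.ofReal (dist y x ^ (-α) / l (dist y x)) ∂μ
      ≤ ENNReal.ofReal (D * R ^ (-α) * ((2 : ℝ) ^ (-α)) ^ k) := by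
    intro k
    have hr : 0 < 2 ^ k * R := by positivity
    have hl := hpos _ hr
    calc ∫⁻ y in A k, ENNReal.ofReal (dist y x ^ (-α) / l (dist y x)) ∂μ
        ≤ ∫⁻ _ in A k, ENNReal.ofReal ((2 ^ k * R) ^ (-α) / l (2 ^ k * R)) ∂μ := by
          refine setLIntegral_mono' (hA k) fun y hy => ENNReal.ofReal_le_ofReal ?_
          exact div_le_div₀ (by positivity)
            (Real.rpow_le_rpow_of_nonpos hr hy.1 (neg_nonpos.2 hα.le)) hl (hmono _ _ hr hy.1)
      _ = ENNReal.ofReal ((2 ^ k * R) ^ (-α) / l (2 ^ k * R)) * μ (A k) := setLIntegral_const _ _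
      _ ≤ ENNReal.ofReal ((2 ^ k * R) ^ (-α) / l (2 ^ k * R)) *
            ENNReal.ofReal (D * l (2 ^ k * R)) := by
          gcongr
          calc μ (A k) ≤ μ (Metric.ball x (2 * (2 ^ k * R))) := measure_mono fun y hy => hy.2
            _ ≤ ENNReal.ofReal (l (2 * (2 ^ k * R))) := hball _ (by positivity)
            _ ≤ _ := ENNReal.ofReal_le_ofReal (hdouble _ hr)
      _ = ENNReal.ofReal (D * R ^ (-α) * ((2 : ℝ) ^ (-α)) ^ k) := by
          rw [← ENNReal.ofReal_mul (by positivity), Real.mul_rpow (by positivity) hR.le,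
            ← Real.rpow_natCast, ← Real.rpow_natCast, ← Real.rpow_mul zero_le_two,
            ← Real.rpow_mul zero_le_two, mul_comm (-α)]
          rw [Real.rpow_natCast]
          field_simp
  calc ∫⁻ y in {y | R ≤ dist y x}, ENNReal.ofReal (dist y x ^ (-α) / l (dist y x)) ∂μ
      ≤ ∫⁻ y in ⋃ k, A k, ENNReal.ofReal (dist y x ^ (-α) / l (dist y x)) ∂μ :=
        lintegral_mono_set hcover
    _ ≤ ∑' k, ∫⁻ y in A k, ENNReal.ofReal (dist y x ^ (-α) / l (dist y x)) ∂μ :=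
        lintegral_iUnion_le _ _
    _ ≤ ∑' k, ENNReal.ofReal (D * R ^ (-α) * ((2 : ℝ) ^ (-α)) ^ k) :=
        ENNReal.tsum_le_tsum hannulus
    _ = ENNReal.ofReal (D * (1 - (2 : ℝ) ^ (-α))⁻¹ * R ^ (-α)) := by
        rw [← ENNReal.ofReal_tsum_of_nonneg (fun k => by positivity)
          ((summable_geometric_of_lt_one hq0 hq1).mul_left _), tsum_mul_left,
          tsum_geometric_of_lt_one hq0 hq1]
        congr 1
        ring

/-- For a cube `Q` with center `c_Q` and sidelength `ℓ(Q)`, `b ∈ L^∞(μ)`, `x ∈ Q` and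
`0 < t ≤ ℓ(Q)` one has `|θ_t(b χ_{(3Q)^c})(x)| ≲ ‖b‖_∞ t^α ℓ(Q)^{−α}`; in particular
`∫_{Q^c} |y − c_Q|^{−α} / λ(c_Q, |y − c_Q|) dμ(y) ≲ ℓ(Q)^{−α}`. -/
theorem theta_of_far_part_bound
    (n : ℕ) (hn : 0 < n) (α Clam Cs Csym : ℝ)
    (hα : 0 < α) (hClam : 1 ≤ Clam) (hCs : 0 < Cs) (hCsym : 1 ≤ Csym) :
    ∃ C : ℝ, 0 < C ∧
      ∀ (μ : Measure (Fin n → ℝ)) (lam : (Fin n → ℝ) → ℝ → ℝ)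
        (s : ℝ → (Fin n → ℝ) → (Fin n → ℝ) → ℝ),
        (∀ x r, 0 < r → 0 < lam x r) →
        (∀ x r r', 0 < r → r ≤ r' → lam x r ≤ lam x r') →
        (∀ x r, 0 < r → lam x (2 * r) ≤ Clam * lam x r) →
        (∀ x r, 0 < r → μ (Metric.ball x r) ≤ ENNReal.ofReal (lam x r)) →
        (∀ x y r, 0 < r → dist x y ≤ r → lam x r ≤ Csym * lam y r) →
        (∀ t x y, 0 < t →
          |s t x y| ≤ Cs * t ^ α / (t ^ α * lam x t + dist x y ^ α * lam x (dist x y))) →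
        ∀ (c : Fin n → ℝ) (L : ℝ), 0 < L →
          (∀ (b : (Fin n → ℝ) → ℝ) (B : ℝ), Measurable b → (∀ x, |b x| ≤ B) →
            ∀ x ∈ Cube c L, ∀ t : ℝ, 0 < t → t ≤ L →
              |∫ y in (Cube c (3 * L))ᶜ, s t x y * b y ∂μ| ≤ C * B * t ^ α * L ^ (-α)) ∧
          ∫⁻ y in (Cube c L)ᶜ,
              ENNReal.ofReal (dist y c ^ (-α) / lam c (dist y c)) ∂μ
            ≤ ENNReal.ofReal (C * L ^ (-α)) := by
  set K : ℝ := Clam * (1 - (2 : ℝ) ^ (-α))⁻¹ with hK_def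
  have hK : 0 < K := by
    have : (2 : ℝ) ^ (-α) < 1 :=
      Real.rpow_lt_one_of_one_lt_of_neg one_lt_two (neg_lt_zero.2 hα)
    have : 0 < 1 - (2 : ℝ) ^ (-α) := by linarith
    positivity
  refine ⟨Cs * K + K * 2 ^ α, by positivity, ?_⟩
  intro μ lam s hpos hmono hdouble hball _ hs c L hL
  have key : ∀ x R, 0 < R → ∫⁻ y in {y | R ≤ dist y x},
      ENNReal.ofReal (dist y x ^ (-α) / lam x (dist y x)) ∂μ ≤ ENNReal.ofReal (K * R ^ (-α)) :=
    fun x R hR => lintegral_dist_rpow_div_le μ x (lam x) hα hR (hpos x) (hmono x) (hdouble x)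
      (hball x)
  refine ⟨?_, ?_⟩
  · intro b B _ hbB x hx t ht _
    have hB : 0 ≤ B := (abs_nonneg _).trans (hbB x)
    have hfar : ∀ y ∈ (Cube c (3 * L))ᶜ, L ≤ dist y x := by
      intro y hy
      simp only [Cube, mem_compl_iff, Metric.mem_closedBall, not_le] at hx hy
      linarith [dist_triangle y x c]
    have hpoint : ∀ y ∈ (Cube c (3 * L))ᶜ, ENNReal.ofReal ‖s t x y * b y‖ ≤
        ENNReal.ofReal (Cs * B * t ^ α) *
          ENNReal.ofReal (dist y x ^ (-α) / lam x (dist y x)) := by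
      intro y hy
      have hd : 0 < dist y x := hL.trans_le (hfar y hy)
      have hl := hpos x _ hd
      have hlt := hpos x t ht
      rw [← ENNReal.ofReal_mul (by positivity)]
      refine ENNReal.ofReal_le_ofReal ?_
      rw [Real.norm_eq_abs, abs_mul]
      have hs' : |s t x y| ≤ Cs * t ^ α / (dist y x ^ α * lam x (dist y x)) := by
        refine (hs t x y ht).trans ?_
        rw [dist_comm x y]
        refine div_le_div_of_nonneg_left (by positivity) (by positivity) ?_
        exact le_add_of_nonneg_left (by positivity)
      calc |s t x y| * |b y|
          ≤ Cs * t ^ α / (dist y x ^ α * lam x (dist y x)) * B :=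
            mul_le_mul hs' (hbB y) (abs_nonneg _) (by positivity)
        _ = Cs * B * t ^ α * (dist y x ^ (-α) / lam x (dist y x)) := by
            rw [Real.rpow_neg hd.le]
            field_simp
    have hmeas : MeasurableSet (Cube c (3 * L))ᶜ := Metric.isClosed_closedBall.measurableSet.compl
    have hbound : ∫⁻ y in (Cube c (3 * L))ᶜ, ENNReal.ofReal ‖s t x y * b y‖ ∂μ ≤
        ENNReal.ofReal (Cs * B * t ^ α * (K * L ^ (-α))) :=
      calc ∫⁻ y in (Cube c (3 * L))ᶜ, ENNReal.ofReal ‖s t x y * b y‖ ∂μ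
          ≤ ∫⁻ y in (Cube c (3 * L))ᶜ, ENNReal.ofReal (Cs * B * t ^ α) *
              ENNReal.ofReal (dist y x ^ (-α) / lam x (dist y x)) ∂μ :=
            setLIntegral_mono' hmeas hpoint
        _ = ENNReal.ofReal (Cs * B * t ^ α) * ∫⁻ y in (Cube c (3 * L))ᶜ,
              ENNReal.ofReal (dist y x ^ (-α) / lam x (dist y x)) ∂μ :=
            lintegral_const_mul' _ _ ENNReal.ofReal_ne_top
        _ ≤ ENNReal.ofReal (Cs * B * t ^ α) * ENNReal.ofReal (K * L ^ (-α)) := by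
            gcongr
            exact (lintegral_mono_set hfar).trans (key x L hL)
        _ = _ := (ENNReal.ofReal_mul (by positivity)).symm
    calc |∫ y in (Cube c (3 * L))ᶜ, s t x y * b y ∂μ|
        ≤ (∫⁻ y in (Cube c (3 * L))ᶜ, ENNReal.ofReal ‖s t x y * b y‖ ∂μ).toReal :=
          (Real.norm_eq_abs _).symm.trans_le (norm_integral_le_lintegral_norm _)
      _ ≤ Cs * B * t ^ α * (K * L ^ (-α)) :=
          ENNReal.toReal_le_of_le_ofReal (by positivity) hbound
      _ = Cs * K * (B * t ^ α * L ^ (-α)) := by ring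
      _ ≤ (Cs * K + K * 2 ^ α) * (B * t ^ α * L ^ (-α)) := by
          gcongr
          exact le_add_of_nonneg_right (by positivity)
      _ = (Cs * K + K * 2 ^ α) * B * t ^ α * L ^ (-α) := by ring
  · have hsub : (Cube c L)ᶜ ⊆ {y | L / 2 ≤ dist y c} := by
      intro y hy
      simp only [Cube, mem_compl_iff, Metric.mem_closedBall, not_le] at hy
      exact hy.le
    refine (lintegral_mono_set hsub).trans ((key c (L / 2) (by positivity)).trans ?_)
    refine ENNReal.ofReal_le_ofReal ?_
    rw [Real.div_rpow hL.le zero_le_two, Real.rpow_neg zero_le_two, div_inv_eq_mul]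
    calc K * (L ^ (-α) * 2 ^ α) = K * 2 ^ α * L ^ (-α) := by ring
      _ ≤ (Cs * K + K * 2 ^ α) * L ^ (-α) := by
          gcongr
          exact le_add_of_nonneg_left (by positivity)
end
end

section
/- Define Λ(x,r) := inf_{z ∈ ℝⁿ} λ(z, r + |x − z|). Then: (i) r ↦ Λ(x,r) is non-decreasing; (ii) Λ(x,2r) ≤ C_λ Λ(x,r); (iii) μ(B(x,r)) ≤ Λ(x,r); (iv) Λ(x,r) ≤ λ(x,r); and (v) Λ(x,r) ≤ C_λ Λ(y,r) whenever |x − y| ≤ r. -/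
open MeasureTheory Set

noncomputable section

/-- The modified dominating function `Λ(x,r) := inf_{z ∈ ℝⁿ} λ(z, r + |x − z|)`,
where `ℝⁿ` carries the `ℓ^∞` metric. -/
def BigLambda {n : ℕ} (lam : (Fin n → ℝ) → ℝ → ℝ) (x : Fin n → ℝ) (r : ℝ) : ℝ :=
  ⨅ z : Fin n → ℝ, lam z (r + dist x z)

/-- **(Proposition 1.1 of [HYY]).** If `λ` is non-decreasing in `r`, doubling with constant
`C_λ`, and dominates `μ` on balls, then `Λ(x,r) = inf_z λ(z, r + |x−z|)` is non-decreasing in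
`r`, doubling with the same constant, dominates `μ` on balls, satisfies `Λ ≤ λ`, and has the
symmetry property `Λ(x,r) ≤ C_λ Λ(y,r)` whenever `|x−y| ≤ r`. -/
theorem bigLambda_properties
    (n : ℕ) (hn : 0 < n) (Clam : ℝ) (hClam : 1 ≤ Clam)
    (μ : Measure (Fin n → ℝ)) (lam : (Fin n → ℝ) → ℝ → ℝ)
    (hpos : ∀ x r, 0 < r → 0 < lam x r)
    (hmono : ∀ x r r', 0 < r → r ≤ r' → lam x r ≤ lam x r')
    (hdbl : ∀ x r, 0 < r → lam x (2 * r) ≤ Clam * lam x r)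
    (hdom : ∀ x r, 0 < r → μ (Metric.ball x r) ≤ ENNReal.ofReal (lam x r)) :
    (∀ x r r', 0 < r → r ≤ r' → BigLambda lam x r ≤ BigLambda lam x r') ∧
    (∀ x r, 0 < r → BigLambda lam x (2 * r) ≤ Clam * BigLambda lam x r) ∧
    (∀ x r, 0 < r → μ (Metric.ball x r) ≤ ENNReal.ofReal (BigLambda lam x r)) ∧
    (∀ x r, 0 < r → BigLambda lam x r ≤ lam x r) ∧
    (∀ x y r, 0 < r → dist x y ≤ r → BigLambda lam x r ≤ Clam * BigLambda lam y r) := by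
  have hp : ∀ (x z : Fin n → ℝ) (r : ℝ), 0 < r → 0 < r + dist x z := fun x z r hr =>
    add_pos_of_pos_of_nonneg hr dist_nonneg
  have hle : ∀ (x z : Fin n → ℝ) (r : ℝ), 0 < r → BigLambda lam x r ≤ lam z (r + dist x z) :=
    fun x z r hr => ciInf_le ⟨0, by
      rintro _ ⟨w, rfl⟩
      exact (hpos _ _ (hp x w r hr)).le⟩ z
  have hmul : ∀ (y : Fin n → ℝ) (r a : ℝ), (∀ z, a ≤ Clam * lam z (r + dist y z)) →
      a ≤ Clam * BigLambda lam y r := fun y r a h => by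
    rw [BigLambda, Real.mul_iInf_of_nonneg (zero_le_one.trans hClam)]
    exact le_ciInf h
  refine ⟨fun x r r' hr hrr => le_ciInf fun z => ?_, fun x r hr => hmul _ _ _ fun z => ?_,
    fun x r hr => ?_, fun x r hr => by simpa using hle x x r hr,
    fun x y r hr hxy => hmul _ _ _ fun z => ?_⟩
  · exact (hle x z r hr).trans (hmono _ _ _ (hp x z r hr) (by linarith))
  · refine (hle x z _ (by positivity)).trans
      ((hmono _ _ _ (hp x z _ (by positivity)) ?_).trans (hdbl _ _ (hp x z r hr)))
    linarith [dist_nonneg (x := x) (y := z)]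
  · have hfin : μ (Metric.ball x r) ≠ ⊤ := ne_top_of_le_ne_top ENNReal.ofReal_ne_top (hdom x r hr)
    rw [← ENNReal.ofReal_toReal hfin]
    refine ENNReal.ofReal_le_ofReal (le_ciInf fun z => ?_)
    refine ENNReal.toReal_le_of_le_ofReal (hpos _ _ (hp x z r hr)).le ?_
    exact (measure_mono (Metric.ball_subset_ball' le_rfl)).trans (hdom _ _ (hp x z r hr))
  · refine (hle x z r hr).trans
      ((hmono _ _ _ (hp x z r hr) ?_).trans (hdbl _ _ (hp y z r hr)))
    linarith [dist_triangle x y z, dist_nonneg (x := y) (y := z)]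
end
end

section
/- For dyadic cubes Q, R define A_{QR} = [ℓ(Q)^{α/2} ℓ(R)^{α/2} / (D(Q,R)^α · sup_{z ∈ Q ∪ R} λ(z, D(Q,R)))] · μ(Q)^{1/2} μ(R)^{1/2}, where D(Q,R) = ℓ(Q) + ℓ(R) + d(Q,R). Then for all nonnegative sequences (x_Q), (y_R) indexed by dyadic cubes, Σ_{Q,R} A_{QR} x_Q y_R ≲ (Σ_Q x_Q²)^{1/2} (Σ_R y_R²)^{1/2}, with implied constant depending only on n, α, C_λ. -/
open MeasureTheory Set
open scoped ENNReal

noncomputable section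

/-- The standard (half-open) dyadic cube `2^{-k}([0,1)^n + m)` in `ℝⁿ`. -/
def dcube (n : ℕ) (k : ℤ) (m : Fin n → ℤ) : Set (Fin n → ℝ) :=
  {x | ∀ i, (m i : ℝ) * (2:ℝ) ^ (-k) ≤ x i ∧ x i < ((m i : ℝ) + 1) * (2:ℝ) ^ (-k)}

/-- The `ℓ^∞` distance between two sets in `ℝⁿ`. -/
def sdist {n : ℕ} (A B : Set (Fin n → ℝ)) : ℝ :=
  sInf (Set.image2 dist A B)

/-- `D(Q,R) = ℓ(Q) + ℓ(R) + d(Q,R)` for the dyadic cubes `Q`, `R` indexed by `p`, `q`. -/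
def Ddist (n : ℕ) (p q : ℤ × (Fin n → ℤ)) : ℝ :=
  (2:ℝ) ^ (-p.1) + (2:ℝ) ^ (-q.1) + sdist (dcube n p.1 p.2) (dcube n q.1 q.2)

/-- The matrix
`A_{QR} = [ℓ(Q)^{α/2} ℓ(R)^{α/2} / (D(Q,R)^α · sup_{z ∈ Q ∪ R} λ(z, D(Q,R)))] μ(Q)^{1/2} μ(R)^{1/2}`. -/
def Amat (n : ℕ) (α : ℝ) (μ : Measure (Fin n → ℝ)) (lam : (Fin n → ℝ) → ℝ → ℝ)
    (p q : ℤ × (Fin n → ℤ)) : ℝ≥0∞ :=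
  ENNReal.ofReal
      ((((2:ℝ) ^ (-p.1)) ^ (α / 2) * ((2:ℝ) ^ (-q.1)) ^ (α / 2)) /
        (Ddist n p q ^ α *
          ⨆ z : (dcube n p.1 p.2 ∪ dcube n q.1 q.2 : Set (Fin n → ℝ)), lam z (Ddist n p q))) *
    μ (dcube n p.1 p.2) ^ ((1:ℝ) / 2) * μ (dcube n q.1 q.2) ^ ((1:ℝ) / 2)

/-- Cauchy–Schwarz for sums of extended nonnegative numbers. -/
theorem tsum_mul_le_sqrt_mul_sqrt {ι : Type*} (f g : ι → ℝ≥0∞) :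
    ∑' i, f i * g i ≤ (∑' i, f i ^ 2) ^ ((1:ℝ) / 2) * (∑' i, g i ^ 2) ^ ((1:ℝ) / 2) := by
  let _ : MeasurableSpace ι := ⊤
  have h := ENNReal.lintegral_mul_le_Lp_mul_Lq (μ := Measure.count) (f := f) (g := g)
    Real.HolderConjugate.two_two (measurable_from_top).aemeasurable
    (measurable_from_top).aemeasurable
  have e (u : ι → ℝ≥0∞) : ∫⁻ i, u i ∂Measure.count = ∑' i, u i := by
    rw [Measure.count, lintegral_sum_measure]
    simp
  simpa only [e, Pi.mul_apply, ENNReal.rpow_two] using h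

/-- Schur's test with a common weight for rows and columns. -/
theorem schur_test {ι : Type*} (A : ι → ι → ℝ≥0∞) (w : ι → ℝ≥0∞) (K : ℝ≥0∞)
    (hw : ∀ p, w p ≠ ∞) (hrow0 : ∀ p q, w p = 0 → A p q = 0) (hsymm : ∀ p q, A p q = A q p)
    (hrow : ∀ p, ∑' q, A p q * w q ≤ K * w p) (x y : ι → ℝ≥0∞) :
    ∑' p, ∑' q, A p q * x p * y q
      ≤ K * (∑' p, x p ^ 2) ^ ((1:ℝ) / 2) * (∑' q, y q ^ 2) ^ ((1:ℝ) / 2) := by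
  have half (a : ℝ≥0∞) : (a ^ ((1:ℝ) / 2)) ^ 2 = a := by
    rw [← ENNReal.rpow_natCast, ← ENNReal.rpow_mul]
    norm_num
  have half' (a : ℝ≥0∞) : a ^ ((1:ℝ) / 2) * a ^ ((1:ℝ) / 2) = a := by
    rw [← pow_two, half]
  have bound (u : ι → ℝ≥0∞) :
      ∑' p, ∑' q, A p q * w q * (w p)⁻¹ * u p ^ 2 ≤ K * ∑' p, u p ^ 2 := by
    rw [← ENNReal.tsum_mul_left]
    refine ENNReal.tsum_le_tsum fun p => ?_
    simp_rw [mul_assoc, ← mul_assoc (A p _)]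
    rw [ENNReal.tsum_mul_right, ← mul_assoc]
    refine mul_le_mul_left ?_ _
    calc _ ≤ K * w p * (w p)⁻¹ := mul_le_mul_left (hrow p) _
      _ ≤ K := by
        rw [mul_assoc]
        exact mul_le_of_le_one_right' (ENNReal.mul_inv_le_one _)
  set f : ι × ι → ℝ≥0∞ := fun z => (A z.1 z.2 * w z.2 * (w z.1)⁻¹) ^ ((1:ℝ) / 2) * x z.1
  set g : ι × ι → ℝ≥0∞ := fun z => (A z.2 z.1 * w z.1 * (w z.2)⁻¹) ^ ((1:ℝ) / 2) * y z.2
  have hfg (p q : ι) : A p q * x p * y q = f (p, q) * g (p, q) := by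
    by_cases hp : w p = 0
    · simp [f, g, hrow0 p q hp, hsymm q p]
    by_cases hq : w q = 0
    · simp [f, g, hrow0 q p hq, hsymm p q]
    have key : (A p q * w q * (w p)⁻¹) * (A q p * w p * (w q)⁻¹) = A p q * A p q := by
      rw [hsymm q p]
      calc _ = A p q * A p q * (w q * (w q)⁻¹) * (w p * (w p)⁻¹) := by ring
        _ = _ := by
          rw [ENNReal.mul_inv_cancel hq (hw q), ENNReal.mul_inv_cancel hp (hw p)]
          simp
    calc A p q * x p * y q
        = ((A p q * w q * (w p)⁻¹) * (A q p * w p * (w q)⁻¹)) ^ ((1:ℝ) / 2) * x p * y q := by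
          rw [key, ENNReal.mul_rpow_of_nonneg _ _ (by norm_num), half']
      _ = _ := by
          rw [ENNReal.mul_rpow_of_nonneg _ _ (by norm_num)]
          ring
  have hf : ∑' z, f z ^ 2 ≤ K * ∑' p, x p ^ 2 := by
    rw [ENNReal.tsum_prod']
    simpa only [f, mul_pow, half] using bound x
  have hg : ∑' z, g z ^ 2 ≤ K * ∑' q, y q ^ 2 := by
    rw [ENNReal.tsum_prod', ENNReal.tsum_comm]
    simpa only [g, mul_pow, half] using bound y
  calc ∑' p, ∑' q, A p q * x p * y q = ∑' z, f z * g z := by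
        rw [ENNReal.tsum_prod']
        simp_rw [hfg]
    _ ≤ (∑' z, f z ^ 2) ^ ((1:ℝ) / 2) * (∑' z, g z ^ 2) ^ ((1:ℝ) / 2) :=
        tsum_mul_le_sqrt_mul_sqrt f g
    _ ≤ (K * ∑' p, x p ^ 2) ^ ((1:ℝ) / 2) * (K * ∑' q, y q ^ 2) ^ ((1:ℝ) / 2) := by
        gcongr
    _ = _ := by
        rw [ENNReal.mul_rpow_of_nonneg _ _ (by norm_num),
          ENNReal.mul_rpow_of_nonneg _ _ (by norm_num)]
        nth_rw 3 [← half' K]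
        ring

theorem corner_mem_dcube (n : ℕ) (k : ℤ) (m : Fin n → ℤ) :
    (fun i => (m i : ℝ) * (2:ℝ) ^ (-k)) ∈ dcube n k m := fun i =>
  ⟨le_rfl, by
    have : (0:ℝ) < 2 ^ (-k) := by positivity
    dsimp only
    linarith⟩

theorem dist_le_of_mem_dcube {n : ℕ} {k : ℤ} {m : Fin n → ℤ} {x z : Fin n → ℝ}
    (hx : x ∈ dcube n k m) (hz : z ∈ dcube n k m) : dist x z ≤ (2:ℝ) ^ (-k) := by
  refine (dist_pi_le_iff (by positivity)).2 fun i => ?_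
  rw [Real.dist_eq, abs_le]
  have h₁ := hx i
  have h₂ := hz i
  constructor <;> linarith

theorem measurableSet_dcube (n : ℕ) (k : ℤ) (m : Fin n → ℤ) : MeasurableSet (dcube n k m) := by
  simp only [dcube, Set.ofPred_forall, Set.ofPred_and]
  exact MeasurableSet.iInter fun i =>
    (measurableSet_le measurable_const (measurable_pi_apply i)).inter
      (measurableSet_lt (measurable_pi_apply i) measurable_const)

theorem pairwise_disjoint_dcube (n : ℕ) (k : ℤ) :
    Pairwise (Function.onFun Disjoint (dcube n k)) := by
  intro m m' hne
  refine disjoint_left.2 fun x hx hx' => hne (funext fun i => ?_)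
  have h2 : (0:ℝ) < 2 ^ (-k) := by positivity
  have h₁ := lt_of_mul_lt_mul_right ((hx i).1.trans_lt (hx' i).2) h2.le
  have h₂ := lt_of_mul_lt_mul_right ((hx' i).1.trans_lt (hx i).2) h2.le
  norm_cast at h₁ h₂
  omega

theorem sdist_nonneg {n : ℕ} (A B : Set (Fin n → ℝ)) : 0 ≤ sdist A B :=
  Real.sInf_nonneg (by rintro _ ⟨a, -, b, -, rfl⟩; exact dist_nonneg)

theorem sdist_comm {n : ℕ} (A B : Set (Fin n → ℝ)) : sdist A B = sdist B A := by
  rw [sdist, sdist, image2_swap]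
  simp_rw [dist_comm]

theorem Ddist_comm (n : ℕ) (p q : ℤ × (Fin n → ℤ)) : Ddist n p q = Ddist n q p := by
  rw [Ddist, Ddist, sdist_comm, add_comm ((2:ℝ) ^ (-p.1))]

theorem sidelength_le_Ddist (n : ℕ) (p q : ℤ × (Fin n → ℤ)) : (2:ℝ) ^ (-p.1) ≤ Ddist n p q := by
  have h₁ : (0:ℝ) < 2 ^ (-q.1) := by positivity
  have h₂ := sdist_nonneg (dcube n p.1 p.2) (dcube n q.1 q.2)
  rw [Ddist]
  linarith

theorem dist_le_Ddist {n : ℕ} {p q : ℤ × (Fin n → ℤ)} {x z : Fin n → ℝ}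
    (hx : x ∈ dcube n p.1 p.2) (hz : z ∈ dcube n q.1 q.2) : dist x z ≤ Ddist n p q := by
  have : dist x z - (2:ℝ) ^ (-p.1) - (2:ℝ) ^ (-q.1) ≤
      sdist (dcube n p.1 p.2) (dcube n q.1 q.2) := by
    refine le_csInf ⟨_, mem_image2_of_mem hx hz⟩ ?_
    rintro _ ⟨u, hu, v, hv, rfl⟩
    have h₁ := dist_le_of_mem_dcube hx hu
    have h₂ := dist_le_of_mem_dcube hv hz
    have h₃ := dist_triangle4 x u v z
    linarith
  rw [Ddist]
  linarith

theorem Amat_comm (n : ℕ) (α : ℝ) (μ : Measure (Fin n → ℝ)) (lam : (Fin n → ℝ) → ℝ → ℝ)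
    (p q : ℤ × (Fin n → ℤ)) : Amat n α μ lam p q = Amat n α μ lam q p := by
  rw [Amat, Amat, Ddist_comm, union_comm, mul_comm (((2:ℝ) ^ (-p.1)) ^ (α / 2)), mul_right_comm]

theorem exists_dyadic_scale (n : ℕ) (p q : ℤ × (Fin n → ℤ)) :
    ∃ i j : ℕ, q.1 = p.1 - i + j ∧ (2:ℝ) ^ (-p.1 + i) ≤ Ddist n p q ∧
      Ddist n p q < 2 * (2:ℝ) ^ (-p.1 + i) := by
  have hp := sidelength_le_Ddist n p q
  have hq := sidelength_le_Ddist n q p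
  rw [Ddist_comm] at hq
  have h0 : (0:ℝ) < 2 ^ (-p.1) := by positivity
  obtain ⟨k, hk₁, hk₂⟩ := exists_mem_Ico_zpow (h0.trans_le hp) (one_lt_two : (1:ℝ) < 2)
  have hpk := (zpow_lt_zpow_iff_right₀ (one_lt_two : (1:ℝ) < 2)).1 (hp.trans_lt hk₂)
  have hqk := (zpow_lt_zpow_iff_right₀ (one_lt_two : (1:ℝ) < 2)).1 (hq.trans_lt hk₂)
  obtain ⟨i, hi⟩ := Int.eq_ofNat_of_zero_le (show 0 ≤ k + p.1 by omega)
  obtain ⟨j, hj⟩ := Int.eq_ofNat_of_zero_le (show 0 ≤ k + q.1 by omega)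
  have hk : -p.1 + i = k := by omega
  refine ⟨i, j, by omega, by rwa [hk], ?_⟩
  rw [hk]
  rwa [zpow_add_one₀ two_ne_zero, mul_comm] at hk₂

theorem sidelength_rpow (k : ℤ) (i : ℕ) (β : ℝ) :
    ((2:ℝ) ^ (k - i)) ^ β = ((2:ℝ) ^ k) ^ β * ((2⁻¹:ℝ) ^ β) ^ i := by
  rw [zpow_sub₀ two_ne_zero, zpow_natCast, div_eq_mul_inv, ← inv_pow,
    Real.mul_rpow (by positivity) (by positivity), Real.rpow_pow_comm (by norm_num)]

theorem Amat_le {n : ℕ} {α : ℝ} (hα : 0 < α) (μ : Measure (Fin n → ℝ))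
    {lam : (Fin n → ℝ) → ℝ → ℝ} (hpos : ∀ x r, 0 < r → 0 < lam x r)
    (hmono : ∀ x r r', 0 < r → r ≤ r' → lam x r ≤ lam x r')
    {p q : ℤ × (Fin n → ℤ)} {z : Fin n → ℝ} (hz : z ∈ dcube n p.1 p.2) {i j : ℕ}
    (hq : q.1 = p.1 - i + j) (hD : (2:ℝ) ^ (-p.1 + i) ≤ Ddist n p q) :
    Amat n α μ lam p q ≤
      ENNReal.ofReal (((2⁻¹:ℝ) ^ (α / 2)) ^ i * ((2⁻¹:ℝ) ^ (α / 2)) ^ j /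
        lam z ((2:ℝ) ^ (-p.1 + i))) *
      μ (dcube n p.1 p.2) ^ ((1:ℝ) / 2) * μ (dcube n q.1 q.2) ^ ((1:ℝ) / 2) := by
  rw [Amat]
  refine mul_le_mul_left (mul_le_mul_left (ENNReal.ofReal_le_ofReal ?_) _) _
  have hp' : -p.1 = (-p.1 + i) - i := by omega
  have hq' : -q.1 = (-p.1 + i) - j := by omega
  nth_rw 1 [hp', hq']
  rw [sidelength_rpow, sidelength_rpow]
  generalize -p.1 + (i:ℤ) = k at *
  have hk : (0:ℝ) < 2 ^ k := by positivity
  set ρ : ℝ := (2⁻¹:ℝ) ^ (α / 2)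
  have hρ : 0 < ρ := by positivity
  have hl := hpos z _ hk
  by_cases hb : BddAbove (range fun u : (dcube n p.1 p.2 ∪ dcube n q.1 q.2 : Set (Fin n → ℝ)) =>
      lam u (Ddist n p q))
  · have hS := (hmono z _ _ hk hD).trans (le_ciSup hb ⟨z, Or.inl hz⟩)
    have hsplit : ((2:ℝ) ^ k) ^ (α / 2) * ((2:ℝ) ^ k) ^ (α / 2) = ((2:ℝ) ^ k) ^ α := by
      rw [← Real.rpow_add hk, add_halves]
    have hDα : ((2:ℝ) ^ k) ^ α ≤ Ddist n p q ^ α := Real.rpow_le_rpow hk.le hD hα.le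
    have hkα : 0 < ((2:ℝ) ^ k) ^ α := by positivity
    have hDα' := hkα.trans_le hDα
    rw [mul_mul_mul_comm, hsplit]
    calc _
      ≤ ((2:ℝ) ^ k) ^ α * (ρ ^ i * ρ ^ j) / (((2:ℝ) ^ k) ^ α * lam z (2 ^ k)) := by gcongr
      _ = _ := mul_div_mul_left _ _ hkα.ne'
  · rw [Real.iSup_of_not_bddAbove hb, mul_zero, div_zero]
    positivity

theorem Amat_row_sum_le {n : ℕ} {α Clam : ℝ} (hα : 0 < α) (μ : Measure (Fin n → ℝ))
    {lam : (Fin n → ℝ) → ℝ → ℝ} (hpos : ∀ x r, 0 < r → 0 < lam x r)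
    (hmono : ∀ x r r', 0 < r → r ≤ r' → lam x r ≤ lam x r')
    (hdouble : ∀ x r, 0 < r → lam x (2 * r) ≤ Clam * lam x r)
    (hμ : ∀ x r, 0 < r → μ (Metric.ball x r) ≤ ENNReal.ofReal (lam x r))
    (p : ℤ × (Fin n → ℤ)) :
    ∑' q, Amat n α μ lam p q * μ (dcube n q.1 q.2) ^ ((1:ℝ) / 2) ≤
      ENNReal.ofReal (Clam * ((1 - (2⁻¹:ℝ) ^ (α / 2))⁻¹ * (1 - (2⁻¹:ℝ) ^ (α / 2))⁻¹)) *
        μ (dcube n p.1 p.2) ^ ((1:ℝ) / 2) := by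
  set ρ : ℝ := (2⁻¹:ℝ) ^ (α / 2)
  have hρ0 : 0 < ρ := by positivity
  have hρ1 : ρ < 1 := Real.rpow_lt_one (by norm_num) (by norm_num) (by positivity)
  have hC : 0 ≤ Clam := by
    have h₁ := hpos 0 1 one_pos
    have h₂ := hpos 0 (2 * 1) (by norm_num)
    exact (pos_of_mul_pos_left (h₂.trans_le (hdouble 0 1 one_pos)) h₁.le).le
  set z : Fin n → ℝ := fun i => (p.2 i : ℝ) * (2:ℝ) ^ (-p.1)
  have hz : z ∈ dcube n p.1 p.2 := corner_mem_dcube n p.1 p.2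
  set W := μ (dcube n p.1 p.2) ^ ((1:ℝ) / 2)
  have half (a : ℝ≥0∞) : a ^ ((1:ℝ) / 2) * a ^ ((1:ℝ) / 2) = a := by
    rw [← pow_two, ← ENNReal.rpow_natCast, ← ENNReal.rpow_mul]
    norm_num
  choose i j hq hD₁ hD₂ using exists_dyadic_scale n p
  set S : ℕ → ℕ → (Fin n → ℤ) → Set (Fin n → ℝ) := fun a b m =>
    dcube n (p.1 - a + b) m ∩ {x | Ddist n p (p.1 - a + b, m) < 2 * (2:ℝ) ^ (-p.1 + a)}
  have hS (a b : ℕ) : ∑' m, μ (S a b m) ≤ ENNReal.ofReal (Clam * lam z (2 ^ (-p.1 + a : ℤ))) := by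
    have hr : (0:ℝ) < 2 ^ (-p.1 + a : ℤ) := by positivity
    calc ∑' m, μ (S a b m) ≤ μ (⋃ m, S a b m) :=
          tsum_meas_le_meas_iUnion_of_disjoint μ
            (fun m => (measurableSet_dcube _ _ _).inter (MeasurableSet.const _))
            (fun m m' h => (pairwise_disjoint_dcube n _ h).mono inter_subset_left inter_subset_left)
      _ ≤ μ (Metric.ball z (2 * 2 ^ (-p.1 + a : ℤ))) := by
          refine measure_mono (iUnion_subset fun m x hx => ?_)
          rw [Metric.mem_ball, dist_comm]
          exact (dist_le_Ddist (q := (p.1 - a + b, m)) hz hx.1).trans_lt hx.2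
      _ ≤ _ := (hμ _ _ (by positivity)).trans (ENNReal.ofReal_le_ofReal (hdouble _ _ hr))
  set G : ℕ × ℕ × (Fin n → ℤ) → ℝ≥0∞ := fun t =>
    ENNReal.ofReal (ρ ^ t.1 * ρ ^ t.2.1 / lam z (2 ^ (-p.1 + t.1 : ℤ))) * W * μ (S t.1 t.2.1 t.2.2)
  have hterm (q : ℤ × (Fin n → ℤ)) :
      Amat n α μ lam p q * μ (dcube n q.1 q.2) ^ ((1:ℝ) / 2) ≤ G (i q, j q, q.2) := by
    have hSq : S (i q) (j q) q.2 = dcube n q.1 q.2 := by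
      simp only [S, ← hq, hD₂, Set.ofPred_true, inter_univ]
    calc _ ≤ _ := mul_le_mul_left (Amat_le hα μ hpos hmono hz (hq q) (hD₁ q)) _
      _ = _ := by
        simp only [G, hSq]
        rw [mul_assoc, half]
  have hinj : Function.Injective fun q : ℤ × (Fin n → ℤ) => (i q, j q, q.2) := by
    intro q q' h
    simp only [Prod.mk.injEq] at h
    exact Prod.ext (by rw [hq q, hq q', h.1, h.2.1]) h.2.2
  have hgeom : ∑' a : ℕ, ENNReal.ofReal ρ ^ a = ENNReal.ofReal (1 - ρ)⁻¹ := by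
    rw [ENNReal.tsum_geometric, ENNReal.ofReal_inv_of_pos (by linarith),
      ENNReal.ofReal_sub _ hρ0.le, ENNReal.ofReal_one]
  calc _ ≤ ∑' q : ℤ × (Fin n → ℤ), G (i q, j q, q.2) := ENNReal.tsum_le_tsum hterm
    _ ≤ ∑' t, G t := ENNReal.tsum_comp_le_tsum_of_injective hinj G
    _ = ∑' a, ∑' b, ∑' m, G (a, b, m) := by simp_rw [ENNReal.tsum_prod']
    _ ≤ ∑' a : ℕ, ∑' b : ℕ,
          ENNReal.ofReal ρ ^ a * (ENNReal.ofReal ρ ^ b * (ENNReal.ofReal Clam * W)) := by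
        refine ENNReal.tsum_le_tsum fun a => ENNReal.tsum_le_tsum fun b => ?_
        simp only [G]
        rw [ENNReal.tsum_mul_left]
        have hl := hpos z (2 ^ (-p.1 + a : ℤ)) (by positivity)
        refine (mul_le_mul_right (hS a b) _).trans_eq ?_
        rw [mul_right_comm, ← ENNReal.ofReal_mul (by positivity), ← ENNReal.ofReal_pow hρ0.le,
          ← ENNReal.ofReal_pow hρ0.le, ← mul_assoc (ENNReal.ofReal (ρ ^ b)),
          ← mul_assoc (ENNReal.ofReal (ρ ^ a)), ← ENNReal.ofReal_mul (by positivity),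
          ← ENNReal.ofReal_mul (by positivity)]
        congr 2
        field_simp
    _ = _ := by
        simp_rw [ENNReal.tsum_mul_left, ENNReal.tsum_mul_right]
        have h1 : 0 ≤ (1 - ρ)⁻¹ := inv_nonneg.2 (by linarith)
        rw [hgeom, ENNReal.ofReal_mul hC, ENNReal.ofReal_mul h1]
        ring

/-- **(Proposition 6.3 of [HM]).** The matrix `A_{QR}` is bounded on `ℓ²` of the dyadic cubes:
`Σ_{Q,R} A_{QR} x_Q y_R ≲ (Σ_Q x_Q²)^{1/2} (Σ_R y_R²)^{1/2}` for nonnegative `x`, `y`, with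
constant depending only on `n`, `α`, `C_λ`. -/
theorem Amat_schur_bound
    (n : ℕ) (hn : 0 < n) (α Clam : ℝ) (hα : 0 < α) (hClam : 1 ≤ Clam) :
    ∃ C : ℝ, 0 < C ∧
      ∀ (μ : Measure (Fin n → ℝ)) (lam : (Fin n → ℝ) → ℝ → ℝ),
        (∀ x r, 0 < r → 0 < lam x r) →
        (∀ x r r', 0 < r → r ≤ r' → lam x r ≤ lam x r') →
        (∀ x r, 0 < r → lam x (2 * r) ≤ Clam * lam x r) →
        (∀ x r, 0 < r → μ (Metric.ball x r) ≤ ENNReal.ofReal (lam x r)) →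
        ∀ x y : ℤ × (Fin n → ℤ) → ℝ≥0∞,
          ∑' p : ℤ × (Fin n → ℤ), ∑' q : ℤ × (Fin n → ℤ), Amat n α μ lam p q * x p * y q
            ≤ ENNReal.ofReal C * (∑' p, x p ^ 2) ^ ((1:ℝ) / 2) *
                (∑' q, y q ^ 2) ^ ((1:ℝ) / 2) := by
  have hρ0 : 0 < (2⁻¹:ℝ) ^ (α / 2) := by positivity
  have hρ1 : (2⁻¹:ℝ) ^ (α / 2) < 1 :=
    Real.rpow_lt_one (by norm_num) (by norm_num) (by positivity)
  have hinv : 0 < (1 - (2⁻¹:ℝ) ^ (α / 2))⁻¹ := inv_pos.2 (by linarith)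
  refine ⟨Clam * ((1 - (2⁻¹:ℝ) ^ (α / 2))⁻¹ * (1 - (2⁻¹:ℝ) ^ (α / 2))⁻¹), by positivity, ?_⟩
  intro μ lam hpos hmono hdouble hμ x y
  refine schur_test (Amat n α μ lam) (fun p => μ (dcube n p.1 p.2) ^ ((1:ℝ) / 2)) _ ?_ ?_
    (Amat_comm n α μ lam) (Amat_row_sum_le hα μ hpos hmono hdouble hμ) x y
  · intro p
    refine ENNReal.rpow_ne_top_of_nonneg (by norm_num) (ne_top_of_le_ne_top ENNReal.ofReal_ne_top
      ((measure_mono fun u hu => ?_).trans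
        (hμ (fun i => (p.2 i : ℝ) * (2:ℝ) ^ (-p.1)) (2 * 2 ^ (-p.1)) (by positivity))))
    have h2 : (0:ℝ) < 2 ^ (-p.1) := by positivity
    have := dist_le_of_mem_dcube hu (corner_mem_dcube n p.1 p.2)
    rw [Metric.mem_ball]
    linarith
  · intro p q h
    rw [Amat, h, mul_zero, zero_mul]
end
end

section
/- Set d := log₂ C_λ and γ := α/(2d + 2α), so that γd + γα = α/2. Let Q, R be cubes with ℓ(R) ≤ ℓ(Q) and d(Q,R) > ℓ(R)^γ ℓ(Q)^{1−γ}, and let x ∈ R. Then ℓ(R)^α / (d(Q,R)^α λ(x, d(Q,R))) ≲ ℓ(Q)^{α/2} ℓ(R)^{α/2} / (D(Q,R)^α λ(x, D(Q,R))), where D(Q,R) = ℓ(Q) + ℓ(R) + d(Q,R). In particular one uses λ(x, ℓ(Q)) ≲ (ℓ(Q)/ℓ(R))^{γd} λ(x, ℓ(R)^γ ℓ(Q)^{1−γ}). -/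
open MeasureTheory Set

noncomputable section

/-- A positive non-decreasing function that doubles with constant `K` grows at most like a power
with exponent `log₂ K`. -/
lemma doubling_growth {f : ℝ → ℝ} {K : ℝ} (hK : 1 ≤ K)
    (hpos : ∀ r, 0 < r → 0 < f r) (hmono : ∀ r r', 0 < r → r ≤ r' → f r ≤ f r')
    (hdbl : ∀ r, 0 < r → f (2 * r) ≤ K * f r) {r s : ℝ} (hr : 0 < r) (hrs : r ≤ s) :
    f s ≤ K * (s / r) ^ Real.logb 2 K * f r := by
  have hK0 : 0 < K := by linarith
  have hs : 0 < s := hr.trans_le hrs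
  have hq : 1 ≤ s / r := (one_le_div hr).2 hrs
  have hq0 : 0 < s / r := by positivity
  have iter : ∀ k : ℕ, f (2 ^ k * r) ≤ K ^ k * f r := by
    intro k
    induction k with
    | zero => simp
    | succ k ih =>
      calc f (2 ^ (k + 1) * r) = f (2 * (2 ^ k * r)) := by ring_nf
        _ ≤ K * f (2 ^ k * r) := hdbl _ (by positivity)
        _ ≤ K * (K ^ k * f r) := by gcongr
        _ = K ^ (k + 1) * f r := by ring
  set t := Real.logb 2 (s / r)
  have ht0 : 0 ≤ t := Real.logb_nonneg (by norm_num) hq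
  have h2t : (2 : ℝ) ^ t = s / r := Real.rpow_logb (by norm_num) (by norm_num) hq0
  have hs_le : s ≤ 2 ^ ⌈t⌉₊ * r := by
    rw [← div_le_iff₀ hr, ← h2t, ← Real.rpow_natCast]
    exact Real.rpow_le_rpow_of_exponent_le (by norm_num) (Nat.le_ceil t)
  have hKt : K ^ t = (s / r) ^ Real.logb 2 K := by
    rw [← h2t, ← Real.rpow_mul (by norm_num), mul_comm, Real.rpow_mul (by norm_num),
      Real.rpow_logb (by norm_num) (by norm_num) hK0]
  have hKk : K ^ ⌈t⌉₊ ≤ K * (s / r) ^ Real.logb 2 K := by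
    rw [← hKt, ← Real.rpow_natCast]
    calc K ^ (⌈t⌉₊ : ℝ) ≤ K ^ (1 + t) :=
          Real.rpow_le_rpow_of_exponent_le hK (by linarith [Nat.ceil_lt_add_one ht0])
      _ = K * K ^ t := by rw [Real.rpow_add hK0, Real.rpow_one]
  calc f s ≤ f (2 ^ ⌈t⌉₊ * r) := hmono _ _ hs hs_le
    _ ≤ K ^ ⌈t⌉₊ * f r := iter _
    _ ≤ K * (s / r) ^ Real.logb 2 K * f r := by
      have := hpos r hr
      gcongr

/-- With `d = log₂ C_λ` and `γ = α/(2d + 2α)` (so that `γd + γα = α/2`): if `ℓ(R) ≤ ℓ(Q)`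
and `d(Q,R) > ℓ(R)^γ ℓ(Q)^{1−γ}`, then for `x ∈ R`,
`ℓ(R)^α / (d(Q,R)^α λ(x, d(Q,R))) ≲ ℓ(Q)^{α/2} ℓ(R)^{α/2} / (D(Q,R)^α λ(x, D(Q,R)))`;
in particular one uses `λ(x, ℓ(Q)) ≲ (ℓ(Q)/ℓ(R))^{γd} λ(x, ℓ(R)^γ ℓ(Q)^{1−γ})`. -/
theorem separated_cubes_lambda_estimate
    (n : ℕ) (hn : 0 < n) (α Clam : ℝ) (hα : 0 < α) (hClam : 1 ≤ Clam)
    (d γ : ℝ) (hd : d = Real.logb 2 Clam) (hγ : γ = α / (2 * d + 2 * α)) :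
    ∃ C : ℝ, 0 < C ∧
      ∀ lam : (Fin n → ℝ) → ℝ → ℝ,
        (∀ x r, 0 < r → 0 < lam x r) →
        (∀ x r r', 0 < r → r ≤ r' → lam x r ≤ lam x r') →
        (∀ x r, 0 < r → lam x (2 * r) ≤ Clam * lam x r) →
        ∀ (cQ : Fin n → ℝ) (LQ : ℝ) (cR : Fin n → ℝ) (LR : ℝ),
          0 < LQ → 0 < LR → LR ≤ LQ →
          LR ^ γ * LQ ^ (1 - γ) < sdist (Cube cQ LQ) (Cube cR LR) →
          ∀ x ∈ Cube cR LR,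
            LR ^ α / (sdist (Cube cQ LQ) (Cube cR LR) ^ α *
                lam x (sdist (Cube cQ LQ) (Cube cR LR))) ≤
              C * (LQ ^ (α / 2) * LR ^ (α / 2)) /
                ((LQ + LR + sdist (Cube cQ LQ) (Cube cR LR)) ^ α *
                  lam x (LQ + LR + sdist (Cube cQ LQ) (Cube cR LR))) ∧
            lam x LQ ≤ C * (LQ / LR) ^ (γ * d) * lam x (LR ^ γ * LQ ^ (1 - γ)) := by
  have hK0 : 0 < Clam := by linarith
  have hd0 : 0 ≤ d := hd ▸ Real.logb_nonneg (by norm_num) hClam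
  have hγ0 : 0 ≤ γ := by rw [hγ]; positivity
  have hγα : γ * (α + d) = α / 2 := by
    rw [hγ]
    have : 2 * d + 2 * α ≠ 0 := by positivity
    field_simp
    ring
  refine ⟨Clam * 3 ^ (α + d), by positivity, ?_⟩
  intro lam hpos hmono hdbl cQ LQ cR LR hLQ hLR hRQ hS x _
  set S := sdist (Cube cQ LQ) (Cube cR LR)
  have growth : ∀ r s, 0 < r → r ≤ s → lam x s ≤ Clam * (s / r) ^ d * lam x r := by
    intro r s hr hrs
    rw [hd]
    exact doubling_growth hClam (hpos x) (hmono x) (hdbl x) hr hrs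
  have hq : 1 ≤ LQ / LR := (one_le_div hLR).2 hRQ
  have hq0 : 0 < LQ / LR := by positivity
  have hqγ : 1 ≤ (LQ / LR) ^ γ := Real.one_le_rpow hq hγ0
  set m := LR ^ γ * LQ ^ (1 - γ) with hm
  have hm0 : 0 < m := by positivity
  have hmq : (LQ / LR) ^ γ * m = LQ := by
    have : LQ ^ γ * LQ ^ (1 - γ) = LQ := by
      rw [← Real.rpow_add hLQ]; simp
    have hne : LR ^ γ ≠ 0 := by positivity
    rw [hm, Real.div_rpow hLQ.le hLR.le]
    field_simp
    exact this
  have hmLQ : m ≤ LQ := by nlinarith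
  have hS0 : 0 < S := hm0.trans hS
  constructor
  · set D := LQ + LR + S with hD
    have hD0 : 0 < D := by positivity
    have hDS : D / S ≤ 3 * (LQ / LR) ^ γ := by
      rw [div_le_iff₀ hS0]
      nlinarith
    have hpow : (D / S) ^ (α + d) ≤ 3 ^ (α + d) * (LQ / LR) ^ (α / 2) := by
      rw [← hγα, Real.rpow_mul hq0.le, ← Real.mul_rpow (by norm_num) (by positivity)]
      exact Real.rpow_le_rpow (by positivity) hDS (by positivity)
    have hlS := hpos x S hS0
    have hlD := hpos x D hD0
    have hLRα : LR ^ α = LR ^ (α / 2) * LR ^ (α / 2) := by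
      rw [← Real.rpow_add hLR]; ring_nf
    have hDα : D ^ α = (D / S) ^ α * S ^ α := by
      rw [← Real.mul_rpow (by positivity) hS0.le, div_mul_cancel₀ _ hS0.ne']
    have hqα : LR ^ (α / 2) * (LQ / LR) ^ (α / 2) = LQ ^ (α / 2) := by
      rw [← Real.mul_rpow hLR.le hq0.le, mul_div_cancel₀ _ hLR.ne']
    rw [div_le_div_iff₀ (by positivity) (by positivity)]
    calc LR ^ α * (D ^ α * lam x D)
        ≤ LR ^ α * (D ^ α * (Clam * (D / S) ^ d * lam x S)) := by
          gcongr
          exact growth S D hS0 (by linarith)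
      _ = LR ^ α * S ^ α * Clam * lam x S * (D / S) ^ (α + d) := by
          rw [hDα, Real.rpow_add (by positivity)]; ring
      _ ≤ LR ^ α * S ^ α * Clam * lam x S * (3 ^ (α + d) * (LQ / LR) ^ (α / 2)) := by gcongr
      _ = Clam * 3 ^ (α + d) * (LQ ^ (α / 2) * LR ^ (α / 2)) * (S ^ α * lam x S) := by
          rw [hLRα, ← hqα]; ring
  · have hlm := hpos x m hm0
    have h3 : (1 : ℝ) ≤ 3 ^ (α + d) := Real.one_le_rpow (by norm_num) (by positivity)
    have hLQm : LQ / m = (LQ / LR) ^ γ := by rw [div_eq_iff hm0.ne', hmq]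
    calc lam x LQ ≤ Clam * (LQ / m) ^ d * lam x m := growth m LQ hm0 hmLQ
      _ = Clam * 1 * (LQ / LR) ^ (γ * d) * lam x m := by
          rw [hLQm, Real.rpow_mul hq0.le, mul_one]
      _ ≤ Clam * 3 ^ (α + d) * (LQ / LR) ^ (γ * d) * lam x m := by gcongr
end
end

section
/- Let 𝒟 be a dyadic grid on ℝⁿ, γ ∈ (0,1), and r a positive integer with 2^{r(1−γ)} ≥ 3. If R ∈ 𝒟 is good and Q ∈ 𝒟 satisfies ℓ(Q) > 2^r ℓ(R) and d(Q,R) ≤ ℓ(R)^γ ℓ(Q)^{1−γ}, then R ⊂ Q. -/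
open MeasureTheory Set
open scoped ENNReal

noncomputable section

/-- The translation `Σ_{i : 2^{-i} < 2^{-k}} 2^{-i} w_i` applied to dyadic cubes of
generation `k` (sidelength `2^{-k}`) in the random dyadic grid `𝒟(w)`. -/
def shiftVec (n : ℕ) (w : ℤ → Fin n → Bool) (k : ℤ) : Fin n → ℝ :=
  fun i => ∑' j : ℤ, if k < j then (2:ℝ) ^ (-j) * (if w j i then 1 else 0) else 0

/-- The cube `Q + w` of the random dyadic grid `𝒟(w)`, where `Q = 2^{-k}([0,1)^n + m)`. -/
def gcube (n : ℕ) (w : ℤ → Fin n → Bool) (k : ℤ) (m : Fin n → ℤ) : Set (Fin n → ℝ) :=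
  (fun x => shiftVec n w k + x) '' dcube n k m

/-- The cube of generation `k` (sidelength `2^{-k}`) and position `m` of the grid `𝒟(w)` is
*bad* (with parameters `r`, `γ`) if there is a grid cube of sidelength at least `2^r` times
bigger whose boundary it comes too close to. -/
def IsBad (n : ℕ) (γ : ℝ) (r : ℕ) (w : ℤ → Fin n → Bool) (k : ℤ) (m : Fin n → ℤ) : Prop :=
  ∃ (k' : ℤ) (m' : Fin n → ℤ),
    (2:ℝ) ^ r * (2:ℝ) ^ (-k) ≤ (2:ℝ) ^ (-k') ∧
    sdist (gcube n w k m) (frontier (gcube n w k' m')) ≤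
      ((2:ℝ) ^ (-k)) ^ γ * ((2:ℝ) ^ (-k')) ^ (1 - γ)

theorem dcube_convex (n : ℕ) (k : ℤ) (m : Fin n → ℤ) : Convex ℝ (dcube n k m) := by
  have h : dcube n k m = Set.univ.pi fun i =>
      Set.Ico ((m i : ℝ) * (2:ℝ) ^ (-k)) (((m i : ℝ) + 1) * (2:ℝ) ^ (-k)) := by
    ext x
    simp [dcube, Set.mem_pi]
  rw [h]
  exact convex_pi fun i _ => convex_Ico _ _

theorem gcube_convex (n : ℕ) (w : ℤ → Fin n → Bool) (k : ℤ) (m : Fin n → ℤ) :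
    Convex ℝ (gcube n w k m) :=
  (dcube_convex n k m).translate _

theorem sdist_le_dist {n : ℕ} {A B : Set (Fin n → ℝ)} {a b : Fin n → ℝ} (ha : a ∈ A)
    (hb : b ∈ B) : sdist A B ≤ dist a b := by
  refine csInf_le ⟨0, ?_⟩ (Set.mem_image2_of_mem ha hb)
  rintro _ ⟨x, -, y, -, rfl⟩
  exact dist_nonneg

theorem exists_mem_segment_frontier {n : ℕ} {A : Set (Fin n → ℝ)} {x y : Fin n → ℝ}
    (hx : x ∉ A) (hy : y ∈ A) : ∃ z ∈ segment ℝ x y, z ∈ frontier A := by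
  rw [frontier_eq_closure_inter_closure]
  refine isPreconnected_closed_iff.1 (convex_segment x y).isPreconnected _ _ isClosed_closure
    isClosed_closure (fun z _ => ?_) ⟨y, right_mem_segment ℝ x y, subset_closure hy⟩
    ⟨x, left_mem_segment ℝ x y, subset_closure hx⟩
  exact (em (z ∈ A)).imp (fun h => subset_closure h) (fun h => subset_closure h)

/-- A convex set which is not contained in `A` is at least as close to the frontier of `A`
as it is to `A`. -/
theorem sdist_frontier_le {n : ℕ} {A B : Set (Fin n → ℝ)} (hB : Convex ℝ B)
    (hBA : ¬ B ⊆ A) : sdist B (frontier A) ≤ sdist A B := by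
  obtain ⟨x, hxB, hxA⟩ := Set.not_subset.1 hBA
  rcases A.eq_empty_or_nonempty with rfl | hA
  · simp [sdist]
  refine le_csInf (hA.image2 ⟨x, hxB⟩) ?_
  rintro _ ⟨q, hq, p, hp, rfl⟩
  by_cases hpA : p ∈ A
  · obtain ⟨z, hz, hzA⟩ := exists_mem_segment_frontier hxA hpA
    have h := sdist_le_dist (hB.segment_subset hxB hp hz) hzA
    rw [dist_self] at h
    exact h.trans dist_nonneg
  · obtain ⟨z, hz, hzA⟩ := exists_mem_segment_frontier hpA hq
    have h := dist_add_dist_of_mem_segment hz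
    rw [dist_comm q p]
    exact (sdist_le_dist hp hzA).trans (by linarith [dist_nonneg (x := z) (y := q)])

/-- **Goodness forces containment.** Let `𝒟 = 𝒟(w)` be a (translated standard) dyadic grid,
`γ ∈ (0,1)` and `r` a positive integer with `2^{r(1−γ)} ≥ 3`. If `R ∈ 𝒟` is good and
`Q ∈ 𝒟` satisfies `ℓ(Q) > 2^r ℓ(R)` and `d(Q,R) ≤ ℓ(R)^γ ℓ(Q)^{1−γ}`, then `R ⊆ Q`. -/
theorem good_cube_subset_of_close_bigger_cube
    (n : ℕ) (hn : 0 < n) (γ : ℝ) (r : ℕ) (hγ0 : 0 < γ) (hγ1 : γ < 1) (hr : 0 < r)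
    (h3 : (3:ℝ) ≤ 2 ^ ((r : ℝ) * (1 - γ))) :
    ∀ (w : ℤ → Fin n → Bool) (kR : ℤ) (mR : Fin n → ℤ) (kQ : ℤ) (mQ : Fin n → ℤ),
      ¬ IsBad n γ r w kR mR →
      (2:ℝ) ^ r * (2:ℝ) ^ (-kR) < (2:ℝ) ^ (-kQ) →
      sdist (gcube n w kQ mQ) (gcube n w kR mR) ≤
        ((2:ℝ) ^ (-kR)) ^ γ * ((2:ℝ) ^ (-kQ)) ^ (1 - γ) →
      gcube n w kR mR ⊆ gcube n w kQ mQ := by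
  intro w kR mR kQ mQ hgood hlt hd
  by_contra hsub
  exact hgood ⟨kQ, mQ, hlt.le, (sdist_frontier_le (gcube_convex n w kR mR) hsub).trans hd⟩
end
end

section
/- Let 𝒟 be a dyadic grid, γ ∈ (0,1/2] and r a positive integer with 2^{r(1−γ)} ≥ 3. Assume b ∈ L^∞(μ) satisfies ∬_{Q̂} |θ_t b(x)|² dμ(x) dt/t ≲ μ(3Q) for every cube Q. For S ∈ 𝒟 set a_S := Σ_{Q ∈ 𝒟 good, Q^{(r)} = S} ∬_{W_Q} |θ_t b(x)|² dμ(x) dt/t, where Q^{(r)} is the r-th dyadic ancestor of Q and W_Q = Q × (ℓ(Q)/2, ℓ(Q)). Then (a_S) satisfies the Carleson condition: Σ_{S ∈ 𝒟, S ⊂ R} a_S ≲ μ(R) for every R ∈ 𝒟. -/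
open MeasureTheory Set
open scoped Classical
open scoped ENNReal

noncomputable section

/-- The coefficient `a_S = Σ_{Q ∈ 𝒟 good, Q^{(r)} = S} ∬_{W_Q} |θ_t b(x)|² dμ(x) dt/t`,
where `S` is the grid cube of generation `p.1` and position `p.2` of `𝒟(w)`, and `Q^{(r)}`
is the `r`-th dyadic ancestor of `Q`. -/
def carlesonCoeff (n : ℕ) (γ : ℝ) (r : ℕ) (w : ℤ → Fin n → Bool)
    (μ : Measure (Fin n → ℝ)) (s : ℝ → (Fin n → ℝ) → (Fin n → ℝ) → ℝ)
    (b : (Fin n → ℝ) → ℝ) (p : ℤ × (Fin n → ℤ)) : ℝ≥0∞ :=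
  ∑' m' : Fin n → ℤ,
    if ¬ IsBad n γ r w (p.1 + r) m' ∧ gcube n w (p.1 + r) m' ⊆ gcube n w p.1 p.2 then
      ∫⁻ t in Ioo ((2:ℝ) ^ (-(p.1 + r)) / 2) ((2:ℝ) ^ (-(p.1 + r))),
        (∫⁻ x in gcube n w (p.1 + r) m',
          ENNReal.ofReal ((∫ y, s t x y * b y ∂μ) ^ 2) ∂μ) * ENNReal.ofReal t⁻¹
    else 0

/-- A countable family of measurable subsets of `R` covering each point at most `N` times has
total measure at most `N * μ R`. -/
theorem tsum_measure_le_of_overlap {X ι : Type*} [MeasurableSpace X] [Countable ι]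
    (μ : Measure X) (V : ι → Set X) (hV : ∀ i, MeasurableSet (V i)) (R : Set X)
    (hR : MeasurableSet R) (N : ℕ) (hVR : ∀ i, V i ⊆ R)
    (hN : ∀ y, ∃ T : Finset ι, T.card ≤ N ∧ ∀ i, y ∈ V i → i ∈ T) :
    ∑' i, μ (V i) ≤ N * μ R := by
  calc ∑' i, μ (V i) = ∑' i, ∫⁻ y, (V i).indicator 1 y ∂μ := by
        congr 1; ext i; rw [lintegral_indicator_one (hV i)]
    _ = ∫⁻ y, ∑' i, (V i).indicator 1 y ∂μ := by
        rw [lintegral_tsum]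
        exact fun i => (measurable_one.indicator (hV i)).aemeasurable
    _ ≤ ∫⁻ y, R.indicator (fun _ => (N : ℝ≥0∞)) y ∂μ := by
        refine lintegral_mono fun y => ?_
        by_cases hy : y ∈ R
        · obtain ⟨T, hT, hmem⟩ := hN y
          rw [tsum_eq_sum (s := T)
            (fun i hi => Set.indicator_of_notMem (fun h => hi (hmem i h)) _),
            Set.indicator_of_mem hy]
          calc ∑ i ∈ T, (V i).indicator (1 : X → ℝ≥0∞) y ≤ ∑ _i ∈ T, 1 :=
                Finset.sum_le_sum fun i _ => Set.indicator_le_self' (by simp) y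
            _ = (T.card : ℝ≥0∞) := by simp
            _ ≤ N := by exact_mod_cast hT
        · have : ∀ i, (V i).indicator (1 : X → ℝ≥0∞) y = 0 := fun i =>
            Set.indicator_of_notMem (fun h => hy (hVR i h)) _
          simp [this]
    _ = N * μ R := by rw [lintegral_indicator_const hR]

/-- Centres of the mesh of scale `(3/2)^j`. -/
def meshCenter {n : ℕ} (j : ℤ) (m : Fin n → ℤ) : Fin n → ℝ :=
  fun i => m i * ((3 / 2 : ℝ) ^ j / 4)

/-- The Whitney-type condition on a mesh centre: its distance to the complement of `R` is
comparable with its scale. -/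
def IsWhitney {n : ℕ} (R : Set (Fin n → ℝ)) (p : Σ _ : ℤ, Fin n → ℤ) : Prop :=
  15 / 8 * (3 / 2 : ℝ) ^ p.1 ≤ Metric.infDist (meshCenter p.1 p.2) Rᶜ ∧
    Metric.infDist (meshCenter p.1 p.2) Rᶜ ≤ 25 / 8 * (3 / 2 : ℝ) ^ p.1

theorem IsWhitney.infDist_bounds {n : ℕ} {R : Set (Fin n → ℝ)} {p : Σ _ : ℤ, Fin n → ℤ}
    (hp : IsWhitney R p) {y : Fin n → ℝ}
    (hy : y ∈ Cube (meshCenter p.1 p.2) (3 * (3 / 2 : ℝ) ^ p.1)) :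
    3 / 8 * (3 / 2 : ℝ) ^ p.1 ≤ Metric.infDist y Rᶜ ∧
      Metric.infDist y Rᶜ ≤ 37 / 8 * (3 / 2 : ℝ) ^ p.1 := by
  have h1 := Metric.infDist_le_infDist_add_dist (s := Rᶜ) (x := y) (y := meshCenter p.1 p.2)
  have h2 := Metric.infDist_le_infDist_add_dist (s := Rᶜ) (x := meshCenter p.1 p.2) (y := y)
  have h3 := Metric.mem_closedBall.1 hy
  have h4 := Metric.mem_closedBall'.1 hy
  obtain ⟨h5, h6⟩ := hp
  constructor <;> linarith

theorem IsWhitney.cube_subset {n : ℕ} {R : Set (Fin n → ℝ)} {p : Σ _ : ℤ, Fin n → ℤ}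
    (hp : IsWhitney R p) : Cube (meshCenter p.1 p.2) (3 * (3 / 2 : ℝ) ^ p.1) ⊆ R := by
  intro y hy
  by_contra h
  have h0 : Metric.infDist y Rᶜ = 0 := Metric.infDist_zero_of_mem h
  have := (hp.infDist_bounds hy).1
  have : (0 : ℝ) < (3 / 2 : ℝ) ^ p.1 := by positivity
  linarith

theorem le_add_seven_of_infDist_bounds {d : ℝ} {i j : ℤ} (hi : 3 / 8 * (3 / 2 : ℝ) ^ i ≤ d)
    (hj : d ≤ 37 / 8 * (3 / 2 : ℝ) ^ j) : i ≤ j + 7 := by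
  by_contra! h
  have h1 : (3 / 2 : ℝ) ^ (j + 7) ≤ (3 / 2 : ℝ) ^ i :=
    zpow_le_zpow_right₀ (by norm_num) h.le
  rw [zpow_add₀ (by norm_num)] at h1
  have : (0 : ℝ) < (3 / 2 : ℝ) ^ j := by positivity
  norm_num at h1
  linarith

/-- Dilated Whitney cubes have bounded overlap. -/
theorem exists_finset_whitney {n : ℕ} (R : Set (Fin n → ℝ)) (y : Fin n → ℝ) :
    ∃ T : Finset (Σ _ : ℤ, Fin n → ℤ), T.card ≤ 15 * 14 ^ n ∧
      ∀ p, IsWhitney R p → y ∈ Cube (meshCenter p.1 p.2) (3 * (3 / 2 : ℝ) ^ p.1) → p ∈ T := by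
  by_cases hex : ∃ p, IsWhitney R p ∧ y ∈ Cube (meshCenter p.1 p.2) (3 * (3 / 2 : ℝ) ^ p.1)
  · obtain ⟨p₀, hp₀, hy₀⟩ := hex
    have hb₀ := hp₀.infDist_bounds hy₀
    refine ⟨(Finset.Icc (p₀.1 - 7) (p₀.1 + 7)).sigma fun j =>
      Fintype.piFinset fun i => Finset.Icc (⌊y i / ((3 / 2 : ℝ) ^ j / 4)⌋ - 6)
        (⌊y i / ((3 / 2 : ℝ) ^ j / 4)⌋ + 7), ?_, ?_⟩
    · rw [Finset.card_sigma]
      have : ∀ z : ℤ, (z + 7 + 1 - (z - 6)).toNat = 14 := fun z => by omega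
      have h15 : ∀ z : ℤ, (z + 7 + 1 - (z - 7)).toNat = 15 := fun z => by omega
      simp [Fintype.card_piFinset, this, h15]
    · intro p hp hy
      have hb := hp.infDist_bounds hy
      have h1 := le_add_seven_of_infDist_bounds hb.1 hb₀.2
      have h2 := le_add_seven_of_infDist_bounds hb₀.1 hb.2
      simp only [Finset.mem_sigma, Finset.mem_Icc, Fintype.mem_piFinset]
      refine ⟨⟨by omega, h1⟩, fun i => ?_⟩
      have hδ : (0 : ℝ) < (3 / 2 : ℝ) ^ p.1 / 4 := by positivity
      have hd : |y i - p.2 i * ((3 / 2 : ℝ) ^ p.1 / 4)| ≤ 6 * ((3 / 2 : ℝ) ^ p.1 / 4) := by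
        have := (dist_le_pi_dist y (meshCenter p.1 p.2) i).trans (Metric.mem_closedBall.1 hy)
        rw [Real.dist_eq] at this
        refine this.trans (le_of_eq ?_)
        ring
      obtain ⟨hl, hu⟩ := abs_le.1 hd
      have hl' : (p.2 i : ℝ) - 6 ≤ y i / ((3 / 2 : ℝ) ^ p.1 / 4) := by
        rw [le_div_iff₀ hδ]; linarith
      have hu' : y i / ((3 / 2 : ℝ) ^ p.1 / 4) ≤ (p.2 i : ℝ) + 6 := by
        rw [div_le_iff₀ hδ]; linarith
      have h3 : p.2 i - 6 ≤ ⌊y i / ((3 / 2 : ℝ) ^ p.1 / 4)⌋ := by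
        rw [Int.le_floor]; exact_mod_cast hl'
      have h4 : ⌊y i / ((3 / 2 : ℝ) ^ p.1 / 4)⌋ ≤ p.2 i + 6 := by
        have : (⌊y i / ((3 / 2 : ℝ) ^ p.1 / 4)⌋ : ℝ) ≤ (p.2 i : ℝ) + 6 :=
          (Int.floor_le _).trans hu'
        exact_mod_cast this
      omega
  · push Not at hex
    exact ⟨∅, by simp, fun p hp hy => (hex p hp hy).elim⟩

/-- Every point of height less than a third of its distance to `Rᶜ` lies in the Carleson box of
a Whitney cube. -/
theorem exists_isWhitney {n : ℕ} (R : Set (Fin n → ℝ)) {t : ℝ} (ht : 0 < t) {x : Fin n → ℝ}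
    (hx : 3 * t < Metric.infDist x Rᶜ) :
    ∃ p, IsWhitney R p ∧ t < (3 / 2 : ℝ) ^ p.1 ∧
      x ∈ Cube (meshCenter p.1 p.2) ((3 / 2 : ℝ) ^ p.1) := by
  obtain ⟨j, hj1, hj2⟩ := exists_mem_Ico_zpow (x := Metric.infDist x Rᶜ / 2)
    (y := (3 / 2 : ℝ)) (by linarith) (by norm_num)
  rw [zpow_add_one₀ (by norm_num)] at hj2
  have hδ : (0 : ℝ) < (3 / 2 : ℝ) ^ j / 4 := by positivity
  let m : Fin n → ℤ := fun i => round (x i / ((3 / 2 : ℝ) ^ j / 4))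
  have hd : dist x (meshCenter j m) ≤ (3 / 2 : ℝ) ^ j / 8 := by
    rw [dist_pi_le_iff (by positivity)]
    intro i
    have h := abs_sub_round (x i / ((3 / 2 : ℝ) ^ j / 4))
    rw [Real.dist_eq]
    have : x i - meshCenter j m i = (x i / ((3 / 2 : ℝ) ^ j / 4) -
        round (x i / ((3 / 2 : ℝ) ^ j / 4))) * ((3 / 2 : ℝ) ^ j / 4) := by
      simp only [meshCenter, m]
      rw [sub_mul, div_mul_cancel₀ _ hδ.ne']
    rw [this, abs_mul, abs_of_pos hδ]
    nlinarith
  have h1 := Metric.infDist_le_infDist_add_dist (s := Rᶜ) (x := x) (y := meshCenter j m)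
  have h2 := Metric.infDist_le_infDist_add_dist (s := Rᶜ) (x := meshCenter j m) (y := x)
  rw [dist_comm] at h2
  refine ⟨⟨j, m⟩, ⟨?_, ?_⟩, ?_, ?_⟩
  · dsimp only; linarith
  · dsimp only; linarith
  · dsimp only; linarith
  · refine Metric.mem_closedBall.2 (hd.trans ?_)
    dsimp only; linarith

/-- A measure whose Carleson boxes are controlled by `μ` of the dilated cubes gives mass
`≲ μ R` to the points lying below a cone over `R`. -/
theorem measure_tent_le {n : ℕ} (μ : Measure (Fin n → ℝ)) (ν : Measure (ℝ × (Fin n → ℝ)))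
    (A : ℝ≥0∞)
    (hν : ∀ (c : Fin n → ℝ) (L : ℝ), 0 < L → ν (Ioo 0 L ×ˢ Cube c L) ≤ A * μ (Cube c (3 * L)))
    {R : Set (Fin n → ℝ)} (hR : MeasurableSet R) :
    ν {p | 0 < p.1 ∧ 3 * p.1 < Metric.infDist p.2 Rᶜ} ≤
      A * ((15 * 14 ^ n : ℕ) * μ R) := by
  let V : (Σ _ : ℤ, Fin n → ℤ) → Set (Fin n → ℝ) := fun p =>
    {y | IsWhitney R p ∧ y ∈ Cube (meshCenter p.1 p.2) (3 * (3 / 2 : ℝ) ^ p.1)}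
  let U : (Σ _ : ℤ, Fin n → ℤ) → Set (ℝ × (Fin n → ℝ)) := fun p =>
    {q | IsWhitney R p ∧
      q ∈ Ioo 0 ((3 / 2 : ℝ) ^ p.1) ×ˢ Cube (meshCenter p.1 p.2) ((3 / 2 : ℝ) ^ p.1)}
  have hUV : ∀ p, ν (U p) ≤ A * μ (V p) := by
    intro p
    by_cases hp : IsWhitney R p
    · simpa only [U, V, hp, true_and, Set.ofPred_mem_eq] using
        hν (meshCenter p.1 p.2) ((3 / 2 : ℝ) ^ p.1) (by positivity)
    · simp [U, hp]
  calc ν {p | 0 < p.1 ∧ 3 * p.1 < Metric.infDist p.2 Rᶜ} ≤ ν (⋃ p, U p) := by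
        refine measure_mono ?_
        rintro ⟨t, x⟩ ⟨ht, hx⟩
        obtain ⟨p, hp, htp, hxp⟩ := exists_isWhitney R ht hx
        exact mem_iUnion.2 ⟨p, hp, ⟨ht, htp⟩, hxp⟩
    _ ≤ ∑' p, ν (U p) := measure_iUnion_le _
    _ ≤ ∑' p, A * μ (V p) := ENNReal.tsum_le_tsum hUV
    _ = A * ∑' p, μ (V p) := ENNReal.tsum_mul_left
    _ ≤ A * ((15 * 14 ^ n : ℕ) * μ R) := by
        gcongr
        refine tsum_measure_le_of_overlap μ V (fun p => ?_) R hR _ ?_ ?_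
        · exact (MeasurableSet.const _).inter Metric.isClosed_closedBall.measurableSet
        · exact fun p y hy => hy.1.cube_subset hy.2
        · intro y
          obtain ⟨T, hT, hmem⟩ := exists_finset_whitney R y
          exact ⟨T, hT, fun p hp => hmem p hp.1 hp.2⟩

theorem mem_gcube_iff {n : ℕ} {w : ℤ → Fin n → Bool} {k : ℤ} {m : Fin n → ℤ}
    {x : Fin n → ℝ} : x ∈ gcube n w k m ↔
      ∀ i, (m i : ℝ) * (2 : ℝ) ^ (-k) ≤ x i - shiftVec n w k i ∧
        x i - shiftVec n w k i < ((m i : ℝ) + 1) * (2 : ℝ) ^ (-k) := by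
  constructor
  · rintro ⟨y, hy, rfl⟩ i
    simpa using hy i
  · intro h
    exact ⟨x - shiftVec n w k, h, by simp⟩

theorem measurableSet_gcube {n : ℕ} (w : ℤ → Fin n → Bool) (k : ℤ) (m : Fin n → ℤ) :
    MeasurableSet (gcube n w k m) := by
  have : gcube n w k m = ⋂ i, {x | (m i : ℝ) * (2 : ℝ) ^ (-k) ≤ x i - shiftVec n w k i ∧
        x i - shiftVec n w k i < ((m i : ℝ) + 1) * (2 : ℝ) ^ (-k)} := by
    ext x
    simp only [mem_gcube_iff, mem_iInter, mem_ofPred_eq]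
  rw [this]
  refine MeasurableSet.iInter fun i => ?_
  have hi : Measurable fun x : Fin n → ℝ => x i - shiftVec n w k i := by fun_prop
  exact (measurableSet_le measurable_const hi).inter (measurableSet_lt hi measurable_const)

theorem gcube_index_unique {n : ℕ} {w : ℤ → Fin n → Bool} {k : ℤ} {m m' : Fin n → ℤ}
    {x : Fin n → ℝ} (h : x ∈ gcube n w k m) (h' : x ∈ gcube n w k m') : m = m' := by
  ext i
  have h1 := mem_gcube_iff.1 h i
  have h2 := mem_gcube_iff.1 h' i
  have hp : (0 : ℝ) < (2 : ℝ) ^ (-k) := by positivity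
  have h3 := lt_of_mul_lt_mul_right (h1.1.trans_lt h2.2) hp.le
  have h4 := lt_of_mul_lt_mul_right (h2.1.trans_lt h1.2) hp.le
  have h5 : m i < m' i + 1 := by exact_mod_cast h3
  have h6 : m' i < m i + 1 := by exact_mod_cast h4
  omega

theorem generation_le_of_gcube_subset {n : ℕ} (hn : 0 < n) {w : ℤ → Fin n → Bool} {k k' : ℤ}
    {m m' : Fin n → ℤ} (h : gcube n w k m ⊆ gcube n w k' m') : k' ≤ k := by
  by_contra! hlt
  have hlt' : (2 : ℝ) ^ (-k') < (2 : ℝ) ^ (-k) := zpow_lt_zpow_right₀ (by norm_num) (by omega)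
  have hp : (0 : ℝ) < (2 : ℝ) ^ (-k') := by positivity
  have hx : (fun i => shiftVec n w k i + m i * (2 : ℝ) ^ (-k)) ∈ gcube n w k m :=
    mem_gcube_iff.2 fun i => ⟨by simp, by linarith⟩
  have hy : (fun i => shiftVec n w k i + m i * (2 : ℝ) ^ (-k) + (2 : ℝ) ^ (-k')) ∈
      gcube n w k m := mem_gcube_iff.2 fun i => ⟨by linarith, by linarith⟩
  have h1 := (mem_gcube_iff.1 (h hx) ⟨0, hn⟩).1
  have h2 := (mem_gcube_iff.1 (h hy) ⟨0, hn⟩).2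
  linarith

theorem gcube_ne_univ {n : ℕ} (hn : 0 < n) (w : ℤ → Fin n → Bool) (k : ℤ) (m : Fin n → ℤ) :
    gcube n w k m ≠ univ := by
  intro h
  have hx : (fun i => shiftVec n w k i + (m i + 1) * (2 : ℝ) ^ (-k)) ∈ gcube n w k m :=
    h ▸ mem_univ _
  have := (mem_gcube_iff.1 hx ⟨0, hn⟩).2
  linarith

/-- A good cube at least `r` generations below `R` has distance to `Rᶜ` more than three times its
sidelength. -/
theorem three_mul_lt_infDist_of_not_isBad {n : ℕ} (hn : 0 < n) {γ : ℝ} {r : ℕ}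
    (hγ : γ ≤ 1) (h3 : (3 : ℝ) ≤ 2 ^ ((r : ℝ) * (1 - γ))) {w : ℤ → Fin n → Bool} {k kR : ℤ}
    {m mR : Fin n → ℤ} (hk : kR + r ≤ k) (hgood : ¬ IsBad n γ r w k m) {x : Fin n → ℝ}
    (hx : x ∈ gcube n w k m) (hxR : x ∈ gcube n w kR mR) :
    3 * (2 : ℝ) ^ (-k) < Metric.infDist x (gcube n w kR mR)ᶜ := by
  have hq : (0 : ℝ) < (2 : ℝ) ^ (-k) := by positivity
  have hsize : (2 : ℝ) ^ r * (2 : ℝ) ^ (-k) ≤ (2 : ℝ) ^ (-kR) := by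
    rw [← zpow_natCast, ← zpow_add₀ (by norm_num)]
    exact zpow_le_zpow_right₀ (by norm_num) (by omega)
  have hbd : ((2 : ℝ) ^ (-k)) ^ γ * ((2 : ℝ) ^ (-kR)) ^ (1 - γ) <
      sdist (gcube n w k m) (frontier (gcube n w kR mR)) := by
    by_contra! h
    exact hgood ⟨kR, mR, hsize, h⟩
  obtain ⟨y, hy, hxy⟩ := exists_mem_frontier_infDist_compl_eq_dist hxR (gcube_ne_univ hn w kR mR)
  have hle : sdist (gcube n w k m) (frontier (gcube n w kR mR)) ≤ dist x y := by
    refine csInf_le ⟨0, ?_⟩ ⟨x, hx, y, hy, rfl⟩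
    rintro _ ⟨a, -, b, -, rfl⟩
    exact dist_nonneg
  rw [hxy]
  refine lt_of_le_of_lt ?_ (hbd.trans_le hle)
  calc 3 * (2 : ℝ) ^ (-k)
      ≤ 2 ^ ((r : ℝ) * (1 - γ)) * (2 : ℝ) ^ (-k) := by gcongr
    _ = ((2 : ℝ) ^ (-k)) ^ γ * ((2 : ℝ) ^ r * (2 : ℝ) ^ (-k)) ^ (1 - γ) := by
        rw [Real.mul_rpow (by positivity) hq.le, ← Real.rpow_natCast, ← Real.rpow_mul (by norm_num)]
        rw [mul_left_comm, ← Real.rpow_add hq]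
        simp
    _ ≤ ((2 : ℝ) ^ (-k)) ^ γ * ((2 : ℝ) ^ (-kR)) ^ (1 - γ) := by
        gcongr

/-- The sum of the coefficients below `R` is at most the mass of the tent over `R`, when the box
integrals are given by a measure. -/
theorem tsum_whitney_boxes_le {n : ℕ} (hn : 0 < n) {γ : ℝ} {r : ℕ}
    (hγ : γ ≤ 1) (h3 : (3 : ℝ) ≤ 2 ^ ((r : ℝ) * (1 - γ))) (w : ℤ → Fin n → Bool)
    (ν : Measure (ℝ × (Fin n → ℝ))) (kR : ℤ) (mR : Fin n → ℤ) :
    (∑' p : ℤ × (Fin n → ℤ), if gcube n w p.1 p.2 ⊆ gcube n w kR mR then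
        ∑' m' : Fin n → ℤ,
          if ¬ IsBad n γ r w (p.1 + r) m' ∧ gcube n w (p.1 + r) m' ⊆ gcube n w p.1 p.2 then
            ν (Ioo ((2 : ℝ) ^ (-(p.1 + r)) / 2) ((2 : ℝ) ^ (-(p.1 + r))) ×ˢ
              gcube n w (p.1 + r) m')
          else 0
      else 0) ≤ ν {p | 0 < p.1 ∧ 3 * p.1 < Metric.infDist p.2 (gcube n w kR mR)ᶜ} := by
  let W : (ℤ × (Fin n → ℤ)) × (Fin n → ℤ) → Set (ℝ × (Fin n → ℝ)) := fun q =>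
    {z | (gcube n w q.1.1 q.1.2 ⊆ gcube n w kR mR ∧ ¬ IsBad n γ r w (q.1.1 + r) q.2 ∧
        gcube n w (q.1.1 + r) q.2 ⊆ gcube n w q.1.1 q.1.2) ∧
      z ∈ Ioo ((2 : ℝ) ^ (-(q.1.1 + r)) / 2) ((2 : ℝ) ^ (-(q.1.1 + r))) ×ˢ
        gcube n w (q.1.1 + r) q.2}
  have hmeas : ∀ q, MeasurableSet (W q) := fun q =>
    (MeasurableSet.const _).inter (measurableSet_Ioo.prod (measurableSet_gcube w _ _))
  have hgen : ∀ {t : ℝ} {i j : ℤ}, (2 : ℝ) ^ (-(i + r)) / 2 < t → t < (2 : ℝ) ^ (-(j + r)) →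
      j ≤ i := by
    intro t i j h1 h2
    by_contra! hlt
    have : (2 : ℝ) ^ (-(j + r)) ≤ (2 : ℝ) ^ (-(i + r) - 1) :=
      zpow_le_zpow_right₀ (by norm_num) (by omega)
    rw [zpow_sub_one₀ (by norm_num)] at this
    linarith
  have hdisj : Pairwise (Function.onFun Disjoint W) := by
    intro q q' hne
    rw [Function.onFun, Set.disjoint_left]
    rintro ⟨t, x⟩ ⟨⟨-, -, hs⟩, ht, hx⟩ ⟨⟨-, -, hs'⟩, ht', hx'⟩
    obtain ⟨⟨k, m⟩, m'⟩ := q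
    obtain ⟨⟨l, u⟩, u'⟩ := q'
    obtain rfl : k = l := le_antisymm (hgen ht'.1 ht.2) (hgen ht.1 ht'.2)
    obtain rfl := gcube_index_unique hx hx'
    obtain rfl := gcube_index_unique (hs hx) (hs' hx')
    exact hne rfl
  calc _ = ∑' p : ℤ × (Fin n → ℤ), ∑' m', ν (W (p, m')) := by
        refine tsum_congr fun p => ?_
        by_cases hp : gcube n w p.1 p.2 ⊆ gcube n w kR mR
        · rw [if_pos hp]
          refine tsum_congr fun m' => ?_
          split_ifs with h
          · simp only [W, hp, h, not_false_eq_true, true_and, Set.ofPred_mem_eq]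
          · simp [W, hp, h]
        · simp [W, hp]
    _ = ∑' q, ν (W q) := ENNReal.tsum_prod.symm
    _ = ν (⋃ q, W q) := (measure_iUnion hdisj hmeas).symm
    _ ≤ _ := by
        refine measure_mono (iUnion_subset ?_)
        rintro q ⟨t, x⟩ ⟨⟨hSR, hgood, hQS⟩, ht, hx⟩
        have hk := generation_le_of_gcube_subset hn hSR
        have h := three_mul_lt_infDist_of_not_isBad hn hγ h3 (by omega) hgood hx (hSR (hQS hx))
        have hpos : (0 : ℝ) < (2 : ℝ) ^ (-(q.1.1 + r)) / 2 := by positivity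
        have h1 : (2 : ℝ) ^ (-(q.1.1 + r)) / 2 < t := ht.1
        have h2 : t < (2 : ℝ) ^ (-(q.1.1 + r)) := ht.2
        exact ⟨hpos.trans h1, by dsimp only; linarith⟩

theorem sigmaFinite_of_measure_ball_lt_top {n : ℕ} (μ : Measure (Fin n → ℝ))
    (h : ∀ x r, 0 < r → μ (Metric.ball x r) < ∞) : SigmaFinite μ := by
  have : IsLocallyFiniteMeasure μ :=
    ⟨fun x => ⟨Metric.ball x 1, Metric.ball_mem_nhds x one_pos, h x 1 one_pos⟩⟩
  infer_instance

/-- **The Carleson condition for the coefficients `a_S`.** If `b ∈ L^∞(μ)` satisfies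
`∬_{Q̂} |θ_t b|² dμ dt/t ≲ μ(3Q)` for every cube `Q`, and `2^{r(1−γ)} ≥ 3`, then the
coefficients `a_S = Σ_{Q good, Q^{(r)} = S} ∬_{W_Q} |θ_t b|² dμ dt/t` satisfy
`Σ_{S ∈ 𝒟, S ⊆ R} a_S ≲ μ(R)` for every `R ∈ 𝒟 = 𝒟(w)`. -/
theorem carleson_coefficients_satisfy_carleson_condition
    (n : ℕ) (hn : 0 < n) (α Clam Cs B Ccar γ : ℝ) (r : ℕ)
    (hα : 0 < α) (hClam : 1 ≤ Clam) (hCs : 0 < Cs) (hB : 0 ≤ B) (hCcar : 0 < Ccar)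
    (hγ0 : 0 < γ) (hγ12 : γ ≤ 1 / 2) (hr : 0 < r)
    (h3 : (3:ℝ) ≤ 2 ^ ((r : ℝ) * (1 - γ))) :
    ∀ (μ : Measure (Fin n → ℝ)) (lam : (Fin n → ℝ) → ℝ → ℝ)
      (s : ℝ → (Fin n → ℝ) → (Fin n → ℝ) → ℝ) (b : (Fin n → ℝ) → ℝ),
      (∀ x r', 0 < r' → 0 < lam x r') →
      (∀ x r' r'', 0 < r' → r' ≤ r'' → lam x r' ≤ lam x r'') →
      (∀ x r', 0 < r' → lam x (2 * r') ≤ Clam * lam x r') →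
      (∀ x r', 0 < r' → μ (Metric.ball x r') ≤ ENNReal.ofReal (lam x r')) →
      Measurable (fun p : ℝ × (Fin n → ℝ) × (Fin n → ℝ) => s p.1 p.2.1 p.2.2) →
      (∀ t x y, 0 < t →
        |s t x y| ≤ Cs * t ^ α / (t ^ α * lam x t + dist x y ^ α * lam x (dist x y))) →
      Measurable b → (∀ x, |b x| ≤ B) →
      (∀ (c : Fin n → ℝ) (L : ℝ), 0 < L →
        ∫⁻ t in Ioo (0 : ℝ) L,
            (∫⁻ x in Cube c L,
              ENNReal.ofReal ((∫ y, s t x y * b y ∂μ) ^ 2) ∂μ) * ENNReal.ofReal t⁻¹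
          ≤ ENNReal.ofReal Ccar * μ (Cube c (3 * L))) →
      ∀ w : ℤ → Fin n → Bool,
        ∃ C : ℝ, 0 < C ∧
          ∀ (kR : ℤ) (mR : Fin n → ℤ),
            (∑' p : ℤ × (Fin n → ℤ),
                if gcube n w p.1 p.2 ⊆ gcube n w kR mR then
                  carlesonCoeff n γ r w μ s b p
                else 0)
              ≤ ENNReal.ofReal C * μ (gcube n w kR mR) := by
  intro μ lam s b _ _ _ hμ hs _ hb _ hcar w
  have : SigmaFinite μ := sigmaFinite_of_measure_ball_lt_top μ fun x r' hr' =>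
    (hμ x r' hr').trans_lt ENNReal.ofReal_lt_top
  have hθ : Measurable fun p : ℝ × (Fin n → ℝ) => ∫ y, s p.1 p.2 y * b y ∂μ := by
    refine (StronglyMeasurable.integral_prod_right (ν := μ)
      (f := fun (p : ℝ × (Fin n → ℝ)) y => s p.1 p.2 y * b y) ?_).measurable
    refine Measurable.stronglyMeasurable ?_
    have h1 : Measurable fun q : (ℝ × (Fin n → ℝ)) × (Fin n → ℝ) =>
        s q.1.1 q.1.2 q.2 := hs.comp MeasurableEquiv.prodAssoc.measurable
    exact h1.mul (hb.comp measurable_snd)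
  let ν : Measure (ℝ × (Fin n → ℝ)) := (volume.prod μ).withDensity fun p =>
    ENNReal.ofReal ((∫ y, s p.1 p.2 y * b y ∂μ) ^ 2) * ENNReal.ofReal p.1⁻¹
  have hν : ∀ (I : Set ℝ) (Q : Set (Fin n → ℝ)), MeasurableSet I → MeasurableSet Q →
      ν (I ×ˢ Q) = ∫⁻ t in I, (∫⁻ x in Q,
        ENNReal.ofReal ((∫ y, s t x y * b y ∂μ) ^ 2) ∂μ) * ENNReal.ofReal t⁻¹ := by
    intro I Q hI hQ
    rw [withDensity_apply _ (hI.prod hQ), setLIntegral_prod]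
    · refine lintegral_congr fun t => ?_
      exact lintegral_mul_const' (ENNReal.ofReal t⁻¹)
        (fun x => ENNReal.ofReal ((∫ y, s t x y * b y ∂μ) ^ 2)) ENNReal.ofReal_ne_top
    · exact ((hθ.pow_const 2).ennreal_ofReal.mul
        measurable_fst.inv.ennreal_ofReal).aemeasurable
  refine ⟨Ccar * (15 * 14 ^ n : ℕ), by positivity, fun kR mR => ?_⟩
  have hbox := tsum_whitney_boxes_le hn (by linarith) h3 w ν kR mR
  simp only [hν _ _ measurableSet_Ioo (measurableSet_gcube w _ _)] at hbox
  refine hbox.trans ((measure_tent_le μ ν (ENNReal.ofReal Ccar) (fun c L hL => ?_)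
    (measurableSet_gcube w kR mR)).trans (le_of_eq ?_))
  · rw [hν _ (Cube c L) measurableSet_Ioo Metric.isClosed_closedBall.measurableSet]
    exact hcar c L hL
  · rw [ENNReal.ofReal_mul hCcar.le, ENNReal.ofReal_natCast, mul_assoc]
end
end
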